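/- arXiv:quant-ph/9804060 — 6 statements merged into one kernel-verified Lean document; each statement's English description precedes it below -/
import Mathlib

section
/- Let 0 < ε ≤ 1, let n be a positive integer, let p = (1+ε)/2, and let μ be the product Bernoulli measure on {0,1}^n in which each coordinate is independently 0 with probability p. Let k = ⌈ε²n/20⌉. Then there exists a bijection F : {0,1}^n → {0,1}^n such that the μ-probability of the set of strings x for which all of the first k coordinates of F(x) equal 0 is at least 1 − exp(−ε²n/50). -/
lemma sum_prod_bool {n : ℕ} (f : Fin n → Bool → ℝ) :
    ∑ x : Fin n → Bool, ∏ i, f i (x i) = ∏ i, (f i false + f i true) := by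
  have h := Finset.prod_univ_sum (fun _ : Fin n => (Finset.univ : Finset Bool)) f
  rw [Fintype.piFinset_univ] at h
  rw [← h]
  refine Finset.prod_congr rfl fun i _ => ?_
  rw [Fintype.sum_bool, add_comm]

lemma exists_perm {α : Type*} [Fintype α] [DecidableEq α] (S T : Finset α)
    (h : S.card ≤ T.card) : ∃ F : α → α, Function.Bijective F ∧ ∀ x ∈ S, F x ∈ T := by
  obtain ⟨T', hT', hc⟩ := Finset.exists_subset_card_eq h
  let e : {x // x ∈ S} ≃ {x // x ∈ T'} := Finset.equivOfCardEq hc.symm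
  refine ⟨e.extendSubtype, e.extendSubtype.bijective, fun x hx => hT' ?_⟩
  exact e.extendSubtype_mem x hx

lemma card_T (n k : ℕ) (hk : k ≤ n) :
    2 ^ (n - k) ≤ (Finset.univ.filter
      (fun y : Fin n → Bool => ∀ i : Fin n, (i : ℕ) < k → y i = false)).card := by
  have : (2 : ℕ) ^ (n - k) = (Finset.univ : Finset (Fin (n - k) → Bool)).card := by simp
  rw [this]
  refine Finset.card_le_card_of_injOn
    (fun y i => if h : (i : ℕ) < k then false else y ⟨i - k, by omega⟩) ?_ ?_
  · intro y _
    simp only [Finset.coe_filter, Finset.mem_univ, true_and, Set.mem_ofPred_eq]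
    intro i hi
    simp [hi]
  · intro y _ z _ hyz
    funext j
    have := congrFun hyz ⟨j + k, by omega⟩
    simpa using this

/-- sign of a bit -/
noncomputable def sgnb (b : Bool) : ℝ := if b = false then 1 else -1

lemma real_ineq (ε : ℝ) (h0 : 0 < ε) (h1 : ε ≤ 1) :
    (1 + ε) / 2 * Real.exp (-(ε / 2)) + (1 - (1 + ε) / 2) * Real.exp (ε / 2)
      ≤ Real.exp (-(27 / 100 * ε ^ 2)) := by
  have hc := Real.cosh_le_exp_half_sq (ε / 2)
  have hs : ε / 2 ≤ Real.sinh (ε / 2) := Real.self_le_sinh_iff.2 (by positivity)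
  rw [Real.cosh_eq] at hc
  rw [Real.sinh_eq] at hs
  have hsq : ε ^ 2 ≤ 1 := by nlinarith
  have he := Real.abs_exp_sub_one_sub_id_le (x := (ε / 2) ^ 2 / 2)
    (by rw [abs_of_nonneg (by positivity)]; nlinarith)
  have he' := (abs_le.1 he).2
  have hl := Real.add_one_le_exp (-(27 / 100 * ε ^ 2))
  have hm := mul_le_mul_of_nonneg_left hs h0.le
  have h4 : ε ^ 4 ≤ ε ^ 2 := by nlinarith [sq_nonneg ε]
  nlinarith


/-- Bits are modeled as `Bool`, with `false` representing the value 0.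
`μ` is the product Bernoulli measure on `{0,1}^n` in which each coordinate is
independently 0 with probability `p = (1+ε)/2`.  With `k = ⌈ε²n/20⌉`, there is a
bijection `F` of `{0,1}^n` such that the `μ`-probability that the first `k`
coordinates of `F x` all equal 0 is at least `1 - exp(-ε²n/50)`. -/
theorem stmt_0 (ε : ℝ) (hε0 : 0 < ε) (hε1 : ε ≤ 1) (n : ℕ) (hn : 0 < n)
    (p : ℝ) (hp : p = (1 + ε) / 2)
    (μ : (Fin n → Bool) → ℝ)
    (hμ : ∀ x, μ x = ∏ i, if x i = false then p else 1 - p)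
    (k : ℕ) (hk : k = ⌈ε ^ 2 * n / 20⌉₊) :
    ∃ F : (Fin n → Bool) → (Fin n → Bool), Function.Bijective F ∧
      1 - Real.exp (-(ε ^ 2 * n / 50)) ≤
        ∑ x : Fin n → Bool,
          if ∀ i : Fin n, (i : ℕ) < k → F x i = false then μ x else 0 := by
  classical
  have hnR : (0 : ℝ) < n := by exact_mod_cast hn
  have hp0 : 0 ≤ p := by rw [hp]; linarith
  have hp1 : 0 ≤ 1 - p := by rw [hp]; linarith
  have hpos : 0 < ε ^ 2 * n := by positivity
  have hμ0 : ∀ x, 0 ≤ μ x := by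
    intro x
    rw [hμ]
    refine Finset.prod_nonneg fun i _ => ?_
    split_ifs <;> assumption
  have hμ1 : ∑ x, μ x = 1 := by
    simp_rw [hμ]
    rw [sum_prod_bool (fun _ b => if b = false then p else 1 - p)]
    simp
  by_cases hsmall : ε ^ 2 * n ≤ 20
  · have hk1 : k = 1 := by
      rw [hk, Nat.ceil_eq_iff (by norm_num)]
      constructor
      · norm_num; positivity
      · push_cast; linarith
    refine ⟨id, Function.bijective_id, ?_⟩
    have hsum : (∑ x : Fin n → Bool,
          if ∀ i : Fin n, (i : ℕ) < k → id x i = false then μ x else 0) = p := by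
      have : ∀ x : Fin n → Bool,
          (if ∀ i : Fin n, (i : ℕ) < k → id x i = false then μ x else 0)
          = ∏ i, (fun (i : Fin n) (b : Bool) => if b = false then p else
              if i = ⟨0, hn⟩ then 0 else 1 - p) i (x i) := by
        intro x
        split_ifs with h
        · rw [hμ]
          refine Finset.prod_congr rfl fun i _ => ?_
          by_cases hi : i = ⟨0, hn⟩
          · have : x i = false := h i (by rw [hi, hk1]; norm_num)
            simp [this]
          · simp [hi]
        · push Not at h
          obtain ⟨i, hi, hx⟩ := h
          symm
          refine Finset.prod_eq_zero (Finset.mem_univ i) ?_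
          have hi0 : i = ⟨0, hn⟩ := Fin.ext (by simp; omega)
          simp only [id] at hx
          simp [hx, ← hi0]
      rw [Finset.sum_congr rfl fun x _ => this x]
      refine (sum_prod_bool (fun (i : Fin n) (b : Bool) => if b = false then p else
              if i = ⟨0, hn⟩ then 0 else 1 - p)).trans ?_
      rw [Finset.prod_eq_single (⟨0, hn⟩ : Fin n)]
      · simp
      · intro b _ hb
        simp [hb]
      · simp
    rw [hsum]
    have := Real.add_one_le_exp (-(ε ^ 2 * n / 50))
    rw [hp]
    linarith
  · push Not at hsmall
    have hk2 : (k : ℝ) ≤ ε ^ 2 * n / 10 := by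
      have := Nat.ceil_lt_add_one (a := ε ^ 2 * n / 20) (by positivity)
      rw [← hk] at this
      linarith
    have hkn : k ≤ n := by
      have hsq : ε ^ 2 ≤ 1 := by nlinarith
      have := mul_le_mul_of_nonneg_right hsq hnR.le
      have : (k : ℝ) ≤ n := by linarith
      exact_mod_cast this
    let S : Finset (Fin n → Bool) := Finset.univ.filter (fun x => ε * n / 2 ≤ ∑ i, sgnb (x i))
    let T : Finset (Fin n → Bool) := Finset.univ.filter
      (fun y : Fin n → Bool => ∀ i : Fin n, (i : ℕ) < k → y i = false)
    have hS : (S.card : ℝ) ≤ 2 ^ n * Real.exp (-(ε ^ 2 * n / 8)) := by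
      have h1 : (S.card : ℝ) ≤
          ∑ x : Fin n → Bool, Real.exp (-(ε ^ 2 * n / 4)) * ∏ i, Real.exp (ε / 2 * sgnb (x i)) := by
        rw [Finset.card_eq_sum_ones]
        push_cast
        rw [Finset.sum_filter]
        refine Finset.sum_le_sum fun x _ => ?_
        rw [← Real.exp_sum, ← Real.exp_add, ← Finset.mul_sum]
        split_ifs with h
        · apply Real.one_le_exp
          nlinarith
        · positivity
      refine h1.trans ?_
      rw [← Finset.mul_sum, sum_prod_bool (fun _ b => Real.exp (ε / 2 * sgnb b))]
      have hc := Real.cosh_le_exp_half_sq (ε / 2)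
      rw [Real.cosh_eq] at hc
      have h2 : Real.exp (ε / 2 * sgnb false) + Real.exp (ε / 2 * sgnb true)
          ≤ 2 * Real.exp (ε ^ 2 / 8) := by
        have e : (ε / 2) ^ 2 / 2 = ε ^ 2 / 8 := by ring
        rw [e] at hc
        simp only [sgnb]
        norm_num
        linarith
      have h3 := pow_le_pow_left₀ (by positivity) h2 n
      rw [Finset.prod_const, Finset.card_univ, Fintype.card_fin]
      calc _ ≤ Real.exp (-(ε ^ 2 * n / 4)) * (2 * Real.exp (ε ^ 2 / 8)) ^ n := by gcongr
        _ = 2 ^ n * (Real.exp (-(ε ^ 2 * n / 4)) * Real.exp (n * (ε ^ 2 / 8))) := by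
            rw [mul_pow, ← Real.exp_nat_mul]; ring
        _ = _ := by rw [← Real.exp_add]; congr 2; ring
    have hST : S.card ≤ T.card := by
      refine le_trans ?_ (card_T n k hkn)
      have h2k : (2 : ℝ) ^ k ≤ Real.exp (ε ^ 2 * n / 8) := by
        have : (2 : ℝ) ≤ Real.exp 1 := by have := Real.add_one_le_exp 1; linarith
        calc (2 : ℝ) ^ k ≤ Real.exp 1 ^ k := by gcongr
          _ = Real.exp k := by rw [← Real.exp_nat_mul]; simp
          _ ≤ _ := Real.exp_le_exp.2 (by linarith)
      have : (S.card : ℝ) ≤ (2 : ℝ) ^ (n - k) := by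
        refine hS.trans ?_
        rw [Real.exp_neg, ← div_eq_mul_inv, div_le_iff₀ (Real.exp_pos _)]
        calc (2 : ℝ) ^ n = 2 ^ (n - k) * 2 ^ k := by rw [← pow_add]; congr 1; omega
          _ ≤ _ := by gcongr
      exact_mod_cast this
    obtain ⟨F, hF, hFS⟩ := exists_perm S T hST
    refine ⟨F, hF, ?_⟩
    have hmiss : ∑ x : Fin n → Bool, (if x ∈ S then 0 else μ x) ≤
        Real.exp (-(ε ^ 2 * n / 50)) := by
      have h1 : ∑ x : Fin n → Bool, (if x ∈ S then 0 else μ x) ≤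
          ∑ x : Fin n → Bool, Real.exp (ε ^ 2 * n / 4) *
            ∏ i, ((if x i = false then p else 1 - p) * Real.exp (-(ε / 2 * sgnb (x i)))) := by
        refine Finset.sum_le_sum fun x _ => ?_
        rw [Finset.prod_mul_distrib, ← hμ, ← Real.exp_sum, Finset.sum_neg_distrib,
          ← Finset.mul_sum, mul_left_comm, ← Real.exp_add]
        split_ifs with h
        · have := hμ0 x
          positivity
        · apply le_mul_of_one_le_right (hμ0 x)
          apply Real.one_le_exp
          have : ∑ i, sgnb (x i) < ε * n / 2 := by
            simpa [S] using h
          nlinarith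
      refine h1.trans ?_
      rw [← Finset.mul_sum, sum_prod_bool
        (fun _ b => (if b = false then p else 1 - p) * Real.exp (-(ε / 2 * sgnb b)))]
      have h2 : (if false = false then p else 1 - p) * Real.exp (-(ε / 2 * sgnb false)) +
          (if true = false then p else 1 - p) * Real.exp (-(ε / 2 * sgnb true))
          ≤ Real.exp (-(27 / 100 * ε ^ 2)) := by
        have := real_ineq ε hε0 hε1
        rw [← hp] at this
        simpa [sgnb] using this
      have h3 := pow_le_pow_left₀ (by simp only [if_true]; split_ifs <;> positivity) h2 n
      rw [Finset.prod_const, Finset.card_univ, Fintype.card_fin]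
      calc _ ≤ Real.exp (ε ^ 2 * n / 4) * (Real.exp (-(27 / 100 * ε ^ 2))) ^ n := by gcongr
        _ = Real.exp (-(ε ^ 2 * n / 50)) := by
            rw [← Real.exp_nat_mul, ← Real.exp_add]; congr 1; ring
    have hle : ∑ x : Fin n → Bool, (if x ∈ S then μ x else 0) ≤
        ∑ x : Fin n → Bool,
          if ∀ i : Fin n, (i : ℕ) < k → F x i = false then μ x else 0 := by
      refine Finset.sum_le_sum fun x _ => ?_
      by_cases h : x ∈ S
      · have : ∀ i : Fin n, (i : ℕ) < k → F x i = false := by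
          simpa [T] using hFS x h
        rw [if_pos h, if_pos this]
      · rw [if_neg h]
        split_ifs
        · exact hμ0 x
        · exact le_rfl
    have hadd : ∑ x : Fin n → Bool, (if x ∈ S then μ x else 0) +
        ∑ x : Fin n → Bool, (if x ∈ S then 0 else μ x) = 1 := by
      rw [← Finset.sum_add_distrib, ← hμ1]
      refine Finset.sum_congr rfl fun x _ => ?_
      split_ifs <;> simp
    linarith
end

section
/- Let ε₀ ∈ (0, 0.856), define ε_{i+1} = 2ε_i/(1+ε_i²), and let k be the least index with ε_k ≥ 0.856 (which exists). Then (∏_{j=0}^{k−1} (1 + ε_j²))² ≤ 6.72, and consequently 4^k ≤ 6.72/ε₀². -/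
lemma aux_log : Real.log (1 + 0.856) - Real.log (1 - 0.856) ≤ 2.5594 := by
  rw [← Real.log_div (by norm_num) (by norm_num)]
  have h1 : Real.log (((1 + 0.856) / (1 - 0.856) : ℝ) ^ 13) ≤ Real.log ((2:ℝ) ^ 48) :=
    Real.log_le_log (by norm_num) (by norm_num)
  rw [Real.log_pow, Real.log_pow] at h1
  have h2 := Real.log_two_lt_d9
  push_cast at h1
  linarith

lemma aux_mono {y a : ℝ} (hy : 0 < y) (hya : y ≤ a) (ha : a < 1) :
    a * (Real.log (1 + y) - Real.log (1 - y)) ≤ y * (Real.log (1 + a) - Real.log (1 - a)) := by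
  have h1 := (Real.hasSum_log_sub_log_of_abs_lt_one
    (x := y) (by rw [abs_of_pos hy]; linarith)).mul_left a
  have h2 := (Real.hasSum_log_sub_log_of_abs_lt_one
    (x := a) (by rw [abs_of_pos (by linarith)]; linarith)).mul_left y
  refine hasSum_le (fun n => ?_) h1 h2
  have h3 : y ^ (2 * n) ≤ a ^ (2 * n) := pow_le_pow_left₀ hy.le hya _
  have h4 : 0 ≤ 2 * (1 / (2 * (n:ℝ) + 1)) * (a * y) := by
    have : 0 < a := by linarith
    positivity
  have := mul_le_mul_of_nonneg_left h3 h4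
  calc _ = 2 * (1 / (2 * (n:ℝ) + 1)) * (a * y) * y ^ (2 * n) := by ring
    _ ≤ _ := this
    _ = _ := by ring

lemma aux_lower {y : ℝ} (hy : 0 < y) (hy1 : y < 1) :
    2 * y ≤ Real.log (1 + y) - Real.log (1 - y) := by
  have h1 := Real.hasSum_log_sub_log_of_abs_lt_one
    (x := y) (by rw [abs_of_pos hy]; linarith)
  have := le_hasSum h1 0 (fun n _ => by positivity)
  simpa using this

lemma aux_double {y : ℝ} (hy : 0 < y) (hy1 : y < 1) :
    Real.log (1 + 2 * y / (1 + y ^ 2)) - Real.log (1 - 2 * y / (1 + y ^ 2)) =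
      2 * (Real.log (1 + y) - Real.log (1 - y)) := by
  have hp : (0:ℝ) < 1 + y ^ 2 := by positivity
  have e1 : 1 + 2 * y / (1 + y ^ 2) = (1 + y) ^ 2 / (1 + y ^ 2) := by field_simp; ring
  have e2 : 1 - 2 * y / (1 + y ^ 2) = (1 - y) ^ 2 / (1 + y ^ 2) := by field_simp; ring
  have h1 : (1 - y) ≠ 0 := by linarith
  have h2 : (1 + y) ≠ 0 := by linarith
  rw [e1, e2, Real.log_div (pow_ne_zero _ h2) hp.ne', Real.log_div (pow_ne_zero _ h1) hp.ne',
    Real.log_pow, Real.log_pow]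
  push_cast
  ring

/-- Let `ε₀ ∈ (0, 0.856)` and define `ε_{i+1} = 2ε_i/(1+ε_i²)`.  A least index
`k` with `ε_k ≥ 0.856` exists, and for it `(∏_{j=0}^{k-1} (1+ε_j²))² ≤ 6.72`
and consequently `4^k ≤ 6.72/ε₀²`. -/
theorem stmt_10 (ε₀ : ℝ) (hε₀ : ε₀ ∈ Set.Ioo (0 : ℝ) 0.856) (e : ℕ → ℝ)
    (h0 : e 0 = ε₀) (hrec : ∀ i, e (i + 1) = 2 * e i / (1 + (e i) ^ 2)) :
    (∃ k : ℕ, (0.856 : ℝ) ≤ e k ∧ ∀ j < k, e j < 0.856) ∧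
    ∀ k : ℕ, ((0.856 : ℝ) ≤ e k ∧ ∀ j < k, e j < 0.856) →
      (∏ j ∈ Finset.range k, (1 + (e j) ^ 2)) ^ 2 ≤ 6.72 ∧
      (4 : ℝ) ^ k ≤ 6.72 / ε₀ ^ 2 := by
  obtain ⟨hpos, hlt⟩ := hε₀
  have hrange : ∀ i, 0 < e i ∧ e i < 1 := by
    intro i
    induction i with
    | zero => rw [h0]; exact ⟨hpos, by norm_num at hlt ⊢; linarith⟩
    | succ i ih =>
      obtain ⟨a, b⟩ := ih
      rw [hrec]
      refine ⟨by positivity, ?_⟩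
      rw [div_lt_one (by positivity)]
      nlinarith [mul_pos (sub_pos.2 b) (sub_pos.2 b)]
  have hL : ∀ i, Real.log (1 + e i) - Real.log (1 - e i) =
      2 ^ i * (Real.log (1 + ε₀) - Real.log (1 - ε₀)) := by
    intro i
    induction i with
    | zero => rw [h0]; ring
    | succ i ih => rw [hrec, aux_double (hrange i).1 (hrange i).2, ih]; ring
  have hP : ∀ i, 2 ^ i * ε₀ = e i * ∏ j ∈ Finset.range i, (1 + (e j) ^ 2) := by
    intro i
    induction i with
    | zero => simp [h0]
    | succ i ih =>
      have hp : (0:ℝ) < 1 + e i ^ 2 := by positivity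
      rw [Finset.prod_range_succ, hrec, pow_succ, mul_right_comm, ih]
      field_simp
  have key : ∀ i, e i < 0.856 → 0.856 * (2 ^ i * (2 * ε₀)) ≤ e i * 2.5594 := by
    intro i hi
    have h1 := aux_mono (hrange i).1 hi.le (by norm_num)
    have h2 := mul_le_mul_of_nonneg_left aux_log (hrange i).1.le
    have h3 : (2:ℝ) ^ i * (2 * ε₀) ≤ 2 ^ i * (Real.log (1 + ε₀) - Real.log (1 - ε₀)) :=
      mul_le_mul_of_nonneg_left (aux_lower hpos (by have := (hrange 0).2; rwa [h0] at this))
        (by positivity)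
    rw [hL i] at h1
    linarith
  constructor
  · have hex : ∃ k, (0.856:ℝ) ≤ e k := by
      by_contra! hcon
      obtain ⟨n, hn⟩ := pow_unbounded_of_one_lt (2 / ε₀) (one_lt_two : (1:ℝ) < 2)
      rw [div_lt_iff₀ hpos] at hn
      have h1 := key n (hcon n)
      have h2 := (hrange n).2
      norm_num at h1
      linarith
    classical
    exact ⟨Nat.find hex, Nat.find_spec hex, fun j hj => not_le.1 (Nat.find_min hex hj)⟩
  · rintro k ⟨hk, hmin⟩
    have hb : (∏ j ∈ Finset.range k, (1 + (e j) ^ 2)) ^ 2 ≤ 6.72 := by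
      cases k with
      | zero => norm_num
      | succ i =>
        have hi := hmin i (Nat.lt_succ_self i)
        have h1 := key i hi
        have hPi := hP i
        rw [Finset.prod_range_succ]
        have hQ : 0 ≤ ∏ j ∈ Finset.range i, (1 + (e j) ^ 2) :=
          Finset.prod_nonneg fun j _ => by positivity
        set Q := ∏ j ∈ Finset.range i, (1 + (e j) ^ 2)
        have he := (hrange i).1
        have h2 : Q ≤ 1.495 := by
          have : e i * (1.712 * Q) ≤ e i * 2.5594 := by
            norm_num at h1 ⊢
            linarith
          have := le_of_mul_le_mul_left this he
          norm_num at this ⊢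
          linarith
        have h3 : 1 + e i ^ 2 ≤ 1 + 0.856 ^ 2 := by gcongr
        have h4 : Q * (1 + e i ^ 2) ≤ 1.495 * (1 + 0.856 ^ 2) := by gcongr
        calc _ ≤ (1.495 * (1 + 0.856 ^ 2) : ℝ) ^ 2 := by gcongr
          _ ≤ _ := by norm_num
    refine ⟨hb, ?_⟩
    rw [le_div_iff₀ (by positivity)]
    have h1 : (4:ℝ) ^ k * ε₀ ^ 2 = (2 ^ k * ε₀) ^ 2 := by
      rw [mul_pow, ← pow_mul, mul_comm k 2, pow_mul]; norm_num
    rw [h1, hP k, mul_pow]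
    obtain ⟨a, b⟩ := hrange k
    have h2 : e k ^ 2 ≤ 1 := by nlinarith
    exact (mul_le_of_le_one_left (sq_nonneg _) h2).trans hb
end

section
/- Let k ≥ 2 be an integer, let 0 ≤ δ ≤ 1, and let X₁,…,X_k be independent {0,1}-valued random variables each equal to 1 with probability δ. Let E be the event that X₁ + ⋯ + X_k is even. Then E[(X₂ + ⋯ + X_k)·1_E] ≤ kδ·(1 − (1−δ)^{k−1}). Moreover P(X₁ + ⋯ + X_k = 1) = kδ(1−δ)^{k−1}. -/
theorem aux_mean (k : ℕ) (δ : ℝ) :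
    (∑ x : Fin k → Bool, (∑ i, if x i = true then (1 : ℝ) else 0) *
      ∏ i, (if x i = true then δ else 1 - δ)) = k * δ := by
  simp_rw [Finset.sum_mul]
  rw [Finset.sum_comm]
  have h : ∀ i : Fin k, (∑ x : Fin k → Bool, (if x i = true then (1 : ℝ) else 0) *
      ∏ i, (if x i = true then δ else 1 - δ)) = δ := by
    intro i
    have h1 := Fintype.prod_sum (fun (j : Fin k) (b : Bool) =>
      (if j = i then (if b = true then (1 : ℝ) else 0) else 1) * (if b = true then δ else 1 - δ))
    simp_rw [Finset.prod_mul_distrib] at h1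
    simp only [Finset.prod_ite_eq', Finset.mem_univ, if_true] at h1
    rw [← h1, Finset.prod_eq_single i]
    · simp
    · intro b _ hb
      simp [hb]
    · simp
  rw [Finset.sum_congr rfl (fun i _ => h i)]
  simp

theorem aux_one (k : ℕ) (δ : ℝ) :
    (∑ x : Fin k → Bool,
      if (∑ i, if x i = true then (1 : ℕ) else 0) = 1 then
        ∏ i, (if x i = true then δ else 1 - δ) else 0) = (k : ℝ) * δ * (1 - δ) ^ (k - 1) := by
  have h : ∀ x : Fin k → Bool, (if (∑ i, if x i = true then (1 : ℕ) else 0) = 1 then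
        ∏ i, (if x i = true then δ else 1 - δ) else 0) =
      ∑ i : Fin k, if x = (fun j => decide (j = i)) then δ * (1 - δ) ^ (k - 1) else 0 := by
    intro x
    have hval : ∀ i : Fin k, (∏ j : Fin k, if j = i then δ else 1 - δ) =
        δ * (1 - δ) ^ (k - 1) := by
      intro i
      rw [← Finset.mul_prod_erase _ _ (Finset.mem_univ i), if_pos rfl,
        Finset.prod_congr rfl (g := fun _ => 1 - δ)]
      · simp
      · intro j hj
        rw [if_neg (Finset.ne_of_mem_erase hj)]
    have hc : (∑ i, if x i = true then (1 : ℕ) else 0) =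
        (Finset.univ.filter (fun i => x i = true)).card := by simp
    rw [hc]
    split_ifs with h1
    · obtain ⟨a, ha⟩ := Finset.card_eq_one.mp h1
      have hx : x = fun j => decide (j = a) := by
        funext j
        have := Finset.ext_iff.mp ha j
        simp at this
        by_cases hj : j = a <;> simp_all
      rw [Finset.sum_eq_single a, if_pos hx, hx]
      · simpa using hval a
      · intro b _ hb
        rw [if_neg]
        intro h2
        have := congrFun (hx.symm.trans h2) b
        simp [hb] at this
      · simp
    · symm
      apply Finset.sum_eq_zero
      intro i _
      rw [if_neg]
      rintro rfl
      apply h1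
      rw [← hc]
      simp
  simp_rw [h]
  rw [Finset.sum_comm]
  simp [mul_assoc]

/-- `X₁, …, X_k` are independent Bernoulli bits (modeled as `Bool`, `true` = 1,
indexed by `Fin k` with `X₁` the coordinate `0`) each equal to 1 with
probability `δ`; their joint distribution is the product measure `μ`.  With `E`
the event that `X₁ + ⋯ + X_k` is even,
`E[(X₂ + ⋯ + X_k)·1_E] ≤ kδ·(1-(1-δ)^{k-1})`, and moreover
`P(X₁ + ⋯ + X_k = 1) = kδ(1-δ)^{k-1}`. -/
theorem stmt_12 (k : ℕ) (hk : 2 ≤ k) (δ : ℝ) (hδ0 : 0 ≤ δ) (hδ1 : δ ≤ 1)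
    (μ : (Fin k → Bool) → ℝ)
    (hμ : ∀ x, μ x = ∏ i, if x i = true then δ else 1 - δ) :
    (∑ x : Fin k → Bool,
        if Even (∑ i, if x i = true then (1 : ℕ) else 0)
          then ((∑ i, if i ≠ (⟨0, by omega⟩ : Fin k) ∧ x i = true
                  then (1 : ℝ) else 0)) * μ x
          else 0) ≤
      (k : ℝ) * δ * (1 - (1 - δ) ^ (k - 1)) ∧
    (∑ x : Fin k → Bool,
        if (∑ i, if x i = true then (1 : ℕ) else 0) = 1 then μ x else 0) =
      (k : ℝ) * δ * (1 - δ) ^ (k - 1) := by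
  obtain rfl : μ = fun x => ∏ i, if x i = true then δ else 1 - δ := funext hμ
  refine ⟨?_, aux_one k δ⟩
  have e : (k : ℝ) * δ * (1 - (1 - δ) ^ (k - 1)) =
    k * δ - (k : ℝ) * δ * (1 - δ) ^ (k - 1) := by ring
  rw [e, ← aux_one, ← aux_mean, ← Finset.sum_sub_distrib]
  apply Finset.sum_le_sum
  intro x _
  have hp : 0 ≤ ∏ i, (if x i = true then δ else 1 - δ) := by
    apply Finset.prod_nonneg
    intro i _
    split_ifs <;> linarith
  have hS : (∑ i, if x i = true then (1 : ℝ) else 0) =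
      ((∑ i, if x i = true then (1 : ℕ) else 0 : ℕ) : ℝ) := by push_cast; rfl
  by_cases hE : Even (∑ i, if x i = true then (1 : ℕ) else 0)
  · rw [if_pos hE, if_neg (fun h1 => by rw [h1] at hE; exact absurd hE (by decide)), sub_zero]
    apply mul_le_mul_of_nonneg_right _ hp
    apply Finset.sum_le_sum
    intro i _
    by_cases hx : x i = true
    · simp only [hx, and_true, if_true]
      split_ifs <;> norm_num
    · simp [hx]
  · rw [if_neg hE, hS]
    split_ifs with h1
    · rw [h1]; simp
    · rw [sub_zero]; positivity
end

section
/- Let δ be a real number with 0 < δ ≤ 0.000158 and set k = δ^{−2/5} (a real number, so k ≥ 33; powers of 1−δ with real exponent are real powers). Then δ · (1 − (1−δ)^{k−1}) · k / ((1−δ)^k · (k−1)) ≤ 1.2 · δ^{8/5}. -/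
/-- For `0 < δ ≤ 0.000158` and `k = δ^{-2/5}` (real powers throughout),
`δ·(1-(1-δ)^{k-1})·k / ((1-δ)^k·(k-1)) ≤ 1.2·δ^{8/5}`. -/
theorem stmt_14 (δ : ℝ) (hδ0 : 0 < δ) (hδ1 : δ ≤ 0.000158)
    (k : ℝ) (hk : k = δ ^ (-(2 : ℝ) / 5)) :
    δ * (1 - (1 - δ) ^ (k - 1)) * k / ((1 - δ) ^ k * (k - 1)) ≤
      1.2 * δ ^ ((8 : ℝ) / 5) := by
  obtain ⟨t, ht0, rfl⟩ : ∃ t : ℝ, 0 < t ∧ δ = t ^ 5 := by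
    refine ⟨δ ^ ((1 : ℝ) / 5), by positivity, ?_⟩
    rw [← Real.rpow_natCast, ← Real.rpow_mul hδ0.le]
    norm_num
  have ht1 : t ≤ 1 / 4 := by
    by_contra h
    push Not at h
    have := pow_lt_pow_left₀ h (by norm_num) (n := 5) (by norm_num)
    norm_num at this hδ1
    linarith
  have h8 : (t ^ 5) ^ ((8 : ℝ) / 5) = t ^ 8 := by
    rw [← Real.rpow_natCast, ← Real.rpow_mul ht0.le, ← Real.rpow_natCast]
    norm_num
  have hk' : k * t ^ 2 = 1 := by
    rw [hk, ← Real.rpow_natCast, ← Real.rpow_mul ht0.le, ← Real.rpow_natCast,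
      ← Real.rpow_add ht0]
    norm_num
  clear hk
  rw [h8]
  have ht2 : t ^ 2 ≤ 1 / 16 := by nlinarith
  have hk2 : 2 ≤ k := by
    by_contra h
    push Not at h
    nlinarith [sq_nonneg t, pow_pos ht0 2]
  have hδ' : t ^ 5 ≤ 1 := by norm_num at hδ1; linarith
  have b1 := one_add_mul_self_le_rpow_one_add (s := -t ^ 5) (by linarith) (p := k - 1) (by linarith)
  have b2 := one_add_mul_self_le_rpow_one_add (s := -t ^ 5) (by linarith) (p := k) (by linarith)
  rw [← sub_eq_add_neg] at b1 b2
  have hkt : k * t ^ 5 = t ^ 3 := by linear_combination t ^ 3 * hk'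
  have ht3 : t ^ 3 ≤ 1 / 64 := by
    have := pow_le_pow_left₀ ht0.le ht1 3
    norm_num at this ⊢
    linarith
  have hA : 5 / 6 ≤ (1 - t ^ 5) ^ k := by linarith
  have hk1 : 0 < k - 1 := by linarith
  rw [div_le_iff₀ (mul_pos (by linarith) hk1)]
  calc t ^ 5 * (1 - (1 - t ^ 5) ^ (k - 1)) * k
      ≤ t ^ 5 * ((k - 1) * t ^ 5) * k := by
        gcongr
        linarith
    _ = t ^ 8 * (k - 1) := by linear_combination (t ^ 8 * (k - 1)) * hk'
    _ = 1.2 * t ^ 8 * (5 / 6 * (k - 1)) := by ring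
    _ ≤ _ := by gcongr
end

section
/- Let (δ_i)_{i≥0} be a sequence of nonnegative reals with δ₀ ≤ 0.000158 and δ_{i+1} ≤ 1.2 · δ_i^{8/5} for all i ≥ 0. Then Σ_{i=0}^{∞} δ_i^{2/5} ≤ 0.037, and consequently ∏_{i=0}^{∞} exp(−1.2 · δ_i^{2/5}) ≥ 0.95. -/
/-- Let `(δ_i)` be nonnegative reals with `δ₀ ≤ 0.000158` and
`δ_{i+1} ≤ 1.2·δ_i^{8/5}` for all `i`.  Then `Σ_i δ_i^{2/5} ≤ 0.037`, and
consequently `∏_i exp(-1.2·δ_i^{2/5}) ≥ 0.95` (real powers throughout). -/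
theorem stmt_16 (δ : ℕ → ℝ) (hpos : ∀ i, 0 ≤ δ i) (h0 : δ 0 ≤ 0.000158)
    (hrec : ∀ i, δ (i + 1) ≤ 1.2 * (δ i) ^ ((8 : ℝ) / 5)) :
    (∑' i : ℕ, (δ i) ^ ((2 : ℝ) / 5)) ≤ 0.037 ∧
    (0.95 : ℝ) ≤ ∏' i : ℕ, Real.exp (-1.2 * (δ i) ^ ((2 : ℝ) / 5)) := by
  obtain ⟨x, hx⟩ : ∃ x : ℕ → ℝ, ∀ i, x i = (δ i) ^ ((2 : ℝ) / 5) := ⟨_, fun _ => rfl⟩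
  have hx0 : ∀ i, 0 ≤ x i := fun i => by rw [hx]; exact Real.rpow_nonneg (hpos i) _
  have h5 : ∀ i, x i ^ 5 = δ i ^ 2 := fun i => by
    rw [hx, ← Real.rpow_natCast, ← Real.rpow_mul (hpos i), ← Real.rpow_natCast]
    norm_num
  have h4 : ∀ i, (δ i) ^ ((8 : ℝ) / 5) = x i ^ 4 := fun i => by
    rw [hx, ← Real.rpow_natCast, ← Real.rpow_mul (hpos i)]
    norm_num
  have step : ∀ i, x i ≤ 0.031 → x (i + 1) ≤ x i * (1 / 7) := fun i hi => by
    have h1 : δ (i + 1) ≤ 1.2 * x i ^ 4 := by rw [← h4]; exact hrec i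
    have h2 : δ (i + 1) ^ 2 ≤ (1.2 * x i ^ 4) ^ 2 := pow_le_pow_left₀ (hpos _) h1 2
    have h3 : x i ^ 3 ≤ 0.031 ^ 3 := pow_le_pow_left₀ (hx0 i) hi 3
    have h6 : 0 ≤ x i ^ 5 := pow_nonneg (hx0 i) 5
    refine le_of_pow_le_pow_left₀ (n := 5) (by norm_num)
      (mul_nonneg (hx0 i) (by norm_num)) ?_
    rw [h5]
    have h7 : x i ^ 3 * x i ^ 5 ≤ 0.031 ^ 3 * x i ^ 5 := mul_le_mul_of_nonneg_right h3 h6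
    have h8 : (1.2 * x i ^ 4) ^ 2 = 1.44 * (x i ^ 3 * x i ^ 5) := by ring
    have h9 : (x i * (1 / 7)) ^ 5 = 1 / 16807 * x i ^ 5 := by ring
    rw [h9]
    norm_num at h7 h8 h2 ⊢
    linarith
  have hxz : x 0 ≤ 0.031 := by
    refine le_of_pow_le_pow_left₀ (n := 5) (by norm_num) (by norm_num) ?_
    rw [h5]
    refine (pow_le_pow_left₀ (hpos 0) h0 2).trans (by norm_num)
  have hb : ∀ i, x i ≤ 0.031 * (1 / 7) ^ i := by
    intro i
    induction i with
    | zero => simpa using hxz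
    | succ k ih =>
      have hp : ((1 : ℝ) / 7) ^ k ≤ 1 := pow_le_one₀ (by norm_num) (by norm_num)
      have := step k (ih.trans (by linarith))
      rw [pow_succ]
      linarith
  have hg : HasSum (fun i : ℕ => (0.031 : ℝ) * (1 / 7) ^ i) (0.031 * (1 - 1 / 7)⁻¹) :=
    (hasSum_geometric_of_lt_one (by norm_num) (by norm_num)).mul_left _
  have hs : Summable x := Summable.of_nonneg_of_le hx0 hb hg.summable
  have hle : ∑' i, x i ≤ 0.037 := by
    refine (hs.tsum_le_tsum hb hg.summable).trans ?_
    rw [hg.tsum_eq]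
    norm_num
  simp only [← hx]
  refine ⟨hle, ?_⟩
  have hp := (hs.hasSum.mul_left (-1.2)).rexp
  have hp2 : ∏' i, Real.exp (-1.2 * x i) = Real.exp (-1.2 * ∑' i, x i) := hp.tprod_eq
  rw [hp2]
  have := Real.add_one_le_exp (-1.2 * ∑' i, x i)
  linarith
end

section
/- Let k ≥ 4 be an integer, let 0 ≤ δ ≤ 1, and let X₁,…,X_k be independent {0,1}-valued random variables each equal to 1 with probability δ. Let P be the event that X₁ + X₂ + X₃ ≥ 1 or X₁ + ⋯ + X_k ≥ 4. Then E[ (X₁ + ⋯ + X_k) · 1_P ] ≤ 3δ + 3kδ² + k·C(k,3)·δ⁴, where C(k,3) is the binomial coefficient. -/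
lemma aux_E (k : ℕ) (δ : ℝ) (S : Finset (Fin k)) :
    ∑ x : Fin k → Bool, (if (∀ i ∈ S, x i = true) then (1:ℝ) else 0) *
      (∏ i, if x i = true then δ else 1 - δ) = δ ^ S.card := by
  have h1 : ∀ x : Fin k → Bool, (if (∀ i ∈ S, x i = true) then (1:ℝ) else 0) *
      (∏ i, if x i = true then δ else 1 - δ) =
      ∏ i, (if i ∈ S then (if x i = true then δ else 0)
        else (if x i = true then δ else 1 - δ)) := by
    intro x
    split_ifs with h
    · rw [one_mul]
      refine Finset.prod_congr rfl fun i _ => ?_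
      by_cases hi : i ∈ S
      · simp [hi, h i hi]
      · simp [hi]
    · push Not at h
      obtain ⟨i, hi, hx⟩ := h
      rw [zero_mul]
      symm
      apply Finset.prod_eq_zero (Finset.mem_univ i)
      simp [hi, hx]
  rw [Finset.sum_congr rfl fun x _ => h1 x]
  have h2 := (Fintype.prod_sum (fun (i : Fin k) (b : Bool) =>
    if i ∈ S then (if b = true then δ else 0) else (if b = true then δ else 1 - δ)))
  rw [← h2]
  have h3 : ∀ i : Fin k, ∑ b : Bool,
    (if i ∈ S then (if b = true then δ else 0) else (if b = true then δ else 1 - δ))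
      = if i ∈ S then δ else 1 := by
    intro i
    by_cases hi : i ∈ S <;> simp [hi]
  rw [Finset.prod_congr rfl fun i _ => h3 i]
  simp

lemma aux_four (n : ℕ) (h : 4 ≤ n) : n ≤ 4 * n.choose 4 := by
  obtain ⟨m, rfl⟩ : ∃ m, n = m + 1 := ⟨n - 1, by omega⟩
  have h1 := Nat.add_one_mul_choose_eq m 3
  have h2 : 0 < m.choose 3 := Nat.choose_pos (by omega)
  nlinarith

lemma aux_choose (k : ℕ) (hk : 4 ≤ k) : 4 * k.choose 4 ≤ k * k.choose 3 := by
  obtain ⟨m, rfl⟩ : ∃ m, k = m + 1 := ⟨k - 1, by omega⟩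
  have h1 := Nat.add_one_mul_choose_eq m 3
  have h2 : m.choose 3 ≤ (m+1).choose 3 := Nat.choose_le_choose 3 (by omega)
  nlinarith

lemma aux_card (k : ℕ) (x : Fin k → Bool) :
    (∑ S ∈ Finset.powersetCard 4 (Finset.univ : Finset (Fin k)),
      if (∀ i ∈ S, x i = true) then (1:ℝ) else 0)
    = ((∑ i, if x i = true then (1 : ℕ) else 0 : ℕ).choose 4 : ℕ) := by
  have h : (∑ i, if x i = true then (1 : ℕ) else 0 : ℕ)
      = (Finset.univ.filter fun i => x i = true).card := by simp
  rw [h, ← Finset.card_powersetCard, Finset.sum_boole]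
  congr 2
  ext S
  simp only [Finset.mem_filter, Finset.mem_powersetCard, Finset.subset_iff, Finset.mem_univ]
  simp [and_comm]

lemma aux_pair (k : ℕ) (x : Fin k → Bool) (j : Fin k) :
    (∑ i, if (∀ l ∈ ({i, j} : Finset (Fin k)), x l = true) then (1:ℝ) else 0)
    = (if x j = true then (1:ℕ) else 0 : ℕ) *
      ((∑ i, if x i = true then (1 : ℕ) else 0 : ℕ) : ℝ) := by
  by_cases h : x j = true <;> simp [h]

lemma aux_Epair (k : ℕ) (δ : ℝ) (hδ0 : 0 ≤ δ) (j : Fin k) :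
    ∑ i : Fin k, δ ^ ({i, j} : Finset (Fin k)).card ≤ δ + k * δ ^ 2 := by
  have : ∀ i ∈ (Finset.univ : Finset (Fin k)),
      δ ^ ({i, j} : Finset (Fin k)).card ≤ (if i = j then δ else 0) + δ ^ 2 := by
    intro i _
    by_cases h : i = j
    · subst h
      simp
      positivity
    · simp [h, Finset.card_pair h]
  refine (Finset.sum_le_sum this).trans ?_
  simp [Finset.sum_add_distrib]


/-- `X₁, …, X_k` are independent Bernoulli bits (modeled as `Bool`, `true` = 1,
indexed by `Fin k` with `X₁, X₂, X₃` the coordinates `0, 1, 2`) each equal to 1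
with probability `δ`; their joint distribution is the product measure `μ`.
With `P` the event that `X₁+X₂+X₃ ≥ 1` or `X₁+⋯+X_k ≥ 4`,
`E[(X₁+⋯+X_k)·1_P] ≤ 3δ + 3kδ² + k·C(k,3)·δ⁴`. -/
theorem stmt_17 (k : ℕ) (hk : 4 ≤ k) (δ : ℝ) (hδ0 : 0 ≤ δ) (hδ1 : δ ≤ 1)
    (μ : (Fin k → Bool) → ℝ)
    (hμ : ∀ x, μ x = ∏ i, if x i = true then δ else 1 - δ) :
    (∑ x : Fin k → Bool,
        if (1 ≤ (if x ⟨0, by omega⟩ = true then (1 : ℕ) else 0) +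
              (if x ⟨1, by omega⟩ = true then (1 : ℕ) else 0) +
              (if x ⟨2, by omega⟩ = true then (1 : ℕ) else 0)) ∨
            (4 ≤ ∑ i, if x i = true then (1 : ℕ) else 0)
          then ((∑ i, if x i = true then (1 : ℕ) else 0 : ℕ) : ℝ) * μ x
          else 0) ≤
      3 * δ + 3 * k * δ ^ 2 + k * (k.choose 3) * δ ^ 4 := by
  have hμ0 : ∀ x, 0 ≤ μ x := by
    intro x
    rw [hμ]
    refine Finset.prod_nonneg fun i _ => ?_
    split_ifs <;> linarith
  have hE : ∀ S : Finset (Fin k), ∑ x : Fin k → Bool,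
      (if (∀ i ∈ S, x i = true) then (1:ℝ) else 0) * μ x = δ ^ S.card := by
    intro S
    rw [← aux_E k δ S]
    exact Finset.sum_congr rfl fun x _ => by rw [hμ]
  have hpair : ∀ j : Fin k, ∑ x : Fin k → Bool,
      ((if x j = true then (1:ℕ) else 0 : ℕ) *
      ((∑ i, if x i = true then (1 : ℕ) else 0 : ℕ) : ℝ)) * μ x ≤ δ + k * δ ^ 2 := by
    intro j
    refine le_trans (le_of_eq ?_) (aux_Epair k δ hδ0 j)
    simp_rw [← aux_pair, Finset.sum_mul]
    rw [Finset.sum_comm]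
    exact Finset.sum_congr rfl fun i _ => hE _
  have hfour : ∑ x : Fin k → Bool,
      (((∑ i, if x i = true then (1 : ℕ) else 0 : ℕ).choose 4 : ℕ) : ℝ) * μ x
      = k.choose 4 * δ ^ 4 := by
    simp_rw [← aux_card, Finset.sum_mul]
    rw [Finset.sum_comm, Finset.sum_congr rfl fun S _ => hE S,
      Finset.sum_congr rfl fun S hS => by rw [(Finset.mem_powersetCard.1 hS).2]]
    simp
  have hch : (4:ℝ) * k.choose 4 ≤ k * k.choose 3 := by exact_mod_cast aux_choose k hk
  have h0 := hpair ⟨0, by omega⟩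
  have h1 := hpair ⟨1, by omega⟩
  have h2 := hpair ⟨2, by omega⟩
  have hδ4 := mul_le_mul_of_nonneg_right hch (pow_nonneg hδ0 4)
  refine le_trans (Finset.sum_le_sum (g := fun x => 
      ((if x ⟨0, by omega⟩ = true then (1:ℕ) else 0 : ℕ) *
        ((∑ i, if x i = true then (1 : ℕ) else 0 : ℕ) : ℝ)) * μ x +
      ((if x ⟨1, by omega⟩ = true then (1:ℕ) else 0 : ℕ) *
        ((∑ i, if x i = true then (1 : ℕ) else 0 : ℕ) : ℝ)) * μ x +
      ((if x ⟨2, by omega⟩ = true then (1:ℕ) else 0 : ℕ) *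
        ((∑ i, if x i = true then (1 : ℕ) else 0 : ℕ) : ℝ)) * μ x +
      4 * ((((∑ i, if x i = true then (1 : ℕ) else 0 : ℕ).choose 4 : ℕ) : ℝ) * μ x)) ?_) ?_
  · intro x _
    generalize (if x ⟨0, by omega⟩ = true then (1:ℕ) else 0) = a
    generalize (if x ⟨1, by omega⟩ = true then (1:ℕ) else 0) = b
    generalize (if x ⟨2, by omega⟩ = true then (1:ℕ) else 0) = c
    generalize (∑ i, if x i = true then (1 : ℕ) else 0) = n
    have hx := hμ0 x
    split_ifs with h
    · have key : n ≤ a * n + b * n + c * n + 4 * n.choose 4 := by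
        rcases h with h | h
        · nlinarith [Nat.mul_le_mul_right n h]
        · have := aux_four n h
          nlinarith [Nat.zero_le (a * n), Nat.zero_le (b * n), Nat.zero_le (c * n)]
      have key' : (n:ℝ) ≤ a * n + b * n + c * n + 4 * n.choose 4 := by exact_mod_cast key
      nlinarith [mul_le_mul_of_nonneg_right key' hx]
    · positivity
  · rw [Finset.sum_add_distrib, Finset.sum_add_distrib, Finset.sum_add_distrib,
      ← Finset.mul_sum, hfour]
    linarith
end
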